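/- Let v be a valuation on a field K, L a finite extension of K, and w_1, …, w_n pairwise distinct extensions of v to L (i.e. with pairwise distinct valuation rings). For any choice of residue classes a_i ∈ κ_{w_i} (1 ≤ i ≤ n), there exists x ∈ L, integral over the valuation ring O_v, such that the residue of x in κ_{w_i} equals a_i for every i. -/

import Mathlib

open Polynomial in
/-- An element lying in every valuation subring above `A` is integral over `A`. -/
lemma aux_isIntegral_of_forall {A L : Type*} [CommRing A] [Field L] [Algebra A L] (x : L)
    (h : ∀ V : ValuationSubring L, (∀ a : A, algebraMap A L a ∈ V) → x ∈ V) :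
    IsIntegral A x := by
  by_contra hx
  have : IsIntegrallyClosedIn (integralClosure A L).toSubring L :=
    inferInstanceAs (IsIntegrallyClosedIn (integralClosure A L) L)
  obtain ⟨V, hV, hxV⟩ :=
    (integralClosure A L).toSubring.exists_le_valuationSubring_of_isIntegrallyClosedIn
      (x := x) hx
  exact hxV (h V fun a => hV ((integralClosure A L).algebraMap_mem a))

/-- Elements integral over `A` lie in every valuation subring above `A`. -/
lemma aux_mem_of_isIntegral {A L : Type*} [CommRing A] [Field L] [Algebra A L] (x : L)
    (hx : IsIntegral A x) (V : ValuationSubring L) (hV : ∀ a : A, algebraMap A L a ∈ V) :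
    x ∈ V := by
  let : Algebra A V := ((algebraMap A L).codRestrict V hV).toAlgebra
  have : IsScalarTower A V L := IsScalarTower.of_algebraMap_eq fun _ => rfl
  obtain ⟨y, rfl⟩ := IsIntegrallyClosed.isIntegral_iff.mp (hx.tower_top (A := V))
  exact y.2

open Polynomial in
lemma aux_step {A L : Type*} [CommRing A] [Field L] [Algebra A L] (x : L) (p : A[X]) (i : ℕ) :
    aeval x (divX^[i + 1] p) * x = aeval x (divX^[i] p) - algebraMap A L (p.coeff i) := by
  have hc : ∀ (i : ℕ) (q : A[X]), (divX^[i] q).coeff 0 = q.coeff i := by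
    intro i
    induction i with
    | zero => intro q; rfl
    | succ k ih => intro q; rw [Function.iterate_succ_apply, ih, coeff_divX]
  have h := congrArg (aeval x) (divX_mul_X_add (divX^[i] p))
  rw [hc] at h
  rw [Function.iterate_succ_apply', ← h]
  simp

open Polynomial in
lemma aux_integral {A L : Type*} [CommRing A] [Field L] [Algebra A L] (x : L) (p : A[X])
    (hp : aeval x p = 0) (i : ℕ) : IsIntegral A (aeval x (divX^[i] p)) := by
  refine aux_isIntegral_of_forall _ fun V hV => ?_
  rcases V.mem_or_inv_mem x with hx | hx
  · rw [aeval_eq_sum_range]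
    refine sum_mem fun k _ => ?_
    rw [Algebra.smul_def]
    exact mul_mem (hV _) (pow_mem hx _)
  · induction i with
    | zero => simp [hp, V.zero_mem]
    | succ k ih =>
      by_cases h0 : x = 0
      · rw [h0, ← coeff_zero_eq_aeval_zero']; exact hV _
      have := aux_step x p k
      rw [← eq_mul_inv_iff_mul_eq₀ h0] at this
      rw [this]
      exact mul_mem (sub_mem ih (hV _)) hx

open Polynomial in
lemma aux_integral' {A L : Type*} [CommRing A] [Field L] [Algebra A L] (x : L) (p : A[X])
    (hp : aeval x p = 0) (i : ℕ) : IsIntegral A (aeval x (divX^[i] p) * x) := by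
  cases i with
  | zero => simpa [hp] using isIntegral_zero
  | succ k =>
    rw [aux_step]
    exact (aux_integral x p hp k).sub isIntegral_algebraMap

open Polynomial in
lemma aux_poly {K L Γ₀ : Type*} [Field K] [Field L] [Algebra K L] [FiniteDimensional K L]
    [LinearOrderedCommGroupWithZero Γ₀] (v : Valuation K Γ₀)
    [Algebra v.valuationSubring L] [IsScalarTower v.valuationSubring K L] (x : L) :
    ∃ p : v.valuationSubring[X], aeval x p = 0 ∧ ∃ j, p.coeff j = 1 := by
  have halg : IsAlgebraic v.valuationSubring x :=
    (IsFractionRing.isAlgebraic_iff v.valuationSubring K L).mpr (Algebra.IsAlgebraic.isAlgebraic x)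
  obtain ⟨p, hp0, hp⟩ := halg
  obtain ⟨j, hj, hmax⟩ := p.support.exists_max_image (fun i => v (p.coeff i : K))
    (nonempty_support_iff.mpr hp0)
  have hne : p.coeff j ≠ 0 := mem_support_iff.mp hj
  have hdvd : C (p.coeff j) ∣ p := by
    rw [C_dvd_iff_dvd_coeff]
    intro i
    by_cases hi : p.coeff i = 0
    · rw [hi]; exact dvd_zero _
    · exact (Valuation.valuationSubring.integers v).dvd_of_le (hmax i (mem_support_iff.mpr hi))
  obtain ⟨q, hq⟩ := hdvd
  refine ⟨q, ?_, j, ?_⟩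
  · rw [hq, map_mul, aeval_C] at hp
    refine (mul_eq_zero.mp hp).resolve_left fun h => hne ?_
    rw [IsScalarTower.algebraMap_apply v.valuationSubring K L] at h
    exact Subtype.ext ((map_eq_zero (algebraMap K L)).mp h)
  · have := congrArg (fun r => r.coeff j) hq
    simp only [coeff_C_mul] at this
    exact (mul_eq_left₀ hne).mp this.symm

/-- Every `x ∈ W` is a fraction of integral elements, with denominator a unit of `W`. -/
lemma aux_frac {K L Γ₀ : Type*} [Field K] [Field L] [Algebra K L] [FiniteDimensional K L]
    [LinearOrderedCommGroupWithZero Γ₀] (v : Valuation K Γ₀)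
    [Algebra v.valuationSubring L] [IsScalarTower v.valuationSubring K L]
    (W : ValuationSubring L) (x : L) (hx : x ∈ W) :
    ∃ s : L, IsIntegral v.valuationSubring s ∧ IsIntegral v.valuationSubring (s * x) ∧
      s ∉ W.nonunits := by
  obtain ⟨p, hp, j, hj⟩ := aux_poly v x
  by_contra! hcon
  have h : ∀ i, _ := fun i => hcon _ (aux_integral x p hp i) (aux_integral' x p hp i)
  have h1 := aux_step x p j
  rw [hj, map_one, eq_sub_iff_add_eq, add_comm, ← eq_sub_iff_add_eq] at h1
  have h2 : (1 : L) ∈ W.nonunits := by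
    rw [h1]
    refine sub_mem (h j) ?_
    rw [ValuationSubring.mem_nonunits_iff, map_mul]
    exact mul_lt_one_of_lt_of_le (h (j + 1)) ((W.valuation_le_one_iff x).mpr hx)
  rw [ValuationSubring.mem_nonunits_iff, map_one] at h2
  exact lt_irrefl _ h2

/-- Let `v` be a valuation on a field `K`, `L` a finite extension of `K`, and `w₁, …, w_n`
pairwise distinct extensions of `v` to `L` (identified with their valuation rings).  For any
choice of residue classes `aᵢ ∈ κ_{wᵢ}`, there exists `x ∈ L`, integral over `𝒪_v`, whose
residue in `κ_{wᵢ}` equals `aᵢ` for every `i`. -/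
theorem exists_integral_with_prescribed_residues
    {K L Γ₀ : Type*} [Field K] [Field L] [Algebra K L] [FiniteDimensional K L]
    [LinearOrderedCommGroupWithZero Γ₀] (v : Valuation K Γ₀)
    [Algebra v.valuationSubring L] [IsScalarTower v.valuationSubring K L]
    {n : ℕ} (W : Fin n → ValuationSubring L)
    (hW : ∀ i, (W i).comap (algebraMap K L) = v.valuationSubring)
    (hdist : ∀ i j, i ≠ j → W i ≠ W j)
    (a : (i : Fin n) → IsLocalRing.ResidueField (W i)) :
    ∃ x : L, IsIntegral v.valuationSubring x ∧
      ∀ i : Fin n, ∃ hx : x ∈ W i, IsLocalRing.residue (W i) ⟨x, hx⟩ = a i := by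
  classical
  have hA : ∀ i (r : v.valuationSubring), algebraMap v.valuationSubring L r ∈ W i := by
    intro i r
    rw [IsScalarTower.algebraMap_apply v.valuationSubring K L]
    have : (r : K) ∈ (W i).comap (algebraMap K L) := by rw [hW i]; exact r.2
    exact this
  let B := integralClosure v.valuationSubring L
  have hB : ∀ i (b : B), (b : L) ∈ W i := fun i b => aux_mem_of_isIntegral _ b.2 _ (hA i)
  let f : ∀ i, B →+* W i := fun i => (B.val : B →+* L).codRestrict (W i) (hB i)
  let M : Fin n → Ideal B := fun i => (IsLocalRing.maximalIdeal (W i)).comap (f i)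
  have hM : ∀ i (b : B), b ∈ M i ↔ (b : L) ∈ (W i).nonunits := fun i b =>
    (ValuationSubring.coe_mem_nonunits_iff (A := W i) (a := f i b)).symm
  have hprime : ∀ i, (M i).IsPrime := fun i => Ideal.comap_isPrime _ _
  have hmax : ∀ i, (M i).IsMaximal := by
    intro i
    have := hprime i
    refine Ideal.isMaximal_of_isIntegral_of_isMaximal_comap (R := v.valuationSubring) (M i) ?_
    have hloc : IsLocalHom ((f i).comp (algebraMap v.valuationSubring B)) := by
      refine ⟨fun r hr => ?_⟩
      obtain ⟨y, hy⟩ := hr.exists_right_inv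
      have hy' : algebraMap K L (r : K) * (y : L) = 1 := by
        have := congrArg (Subtype.val) hy
        change algebraMap K L (algebraMap v.valuationSubring K r) * (y : L) = 1
        rw [← IsScalarTower.algebraMap_apply v.valuationSubring K L r]
        exact this
      have hyK : algebraMap K L ((r : K)⁻¹) = (y : L) := by
        rw [map_inv₀]; exact inv_eq_of_mul_eq_one_right hy'
      have hr0 : (r : K) ≠ 0 := by
        intro h; rw [h, map_zero, zero_mul] at hy'; exact zero_ne_one hy'
      have hmem : (r : K)⁻¹ ∈ v.valuationSubring := by
        have h3 : (r : K)⁻¹ ∈ (W i).comap (algebraMap K L) := by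
          rw [ValuationSubring.mem_comap, hyK]; exact y.2
        exact (hW i).le h3
      exact IsUnit.of_mul_eq_one ⟨_, hmem⟩ (Subtype.ext (mul_inv_cancel₀ hr0))
    have := ((IsLocalRing.local_hom_TFAE ((f i).comp (algebraMap v.valuationSubring B))).out
      0 4).mp hloc
    change (((IsLocalRing.maximalIdeal (W i)).comap (f i)).comap _).IsMaximal
    rw [Ideal.comap_comap, this]
    exact IsLocalRing.maximalIdeal.isMaximal _
  have hle : ∀ i j, M i = M j → W i ≤ W j := by
    intro i j hij x hx
    obtain ⟨s, hs, hsx, hsu⟩ := aux_frac v (W i) x hx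
    have hsj : s ∉ (W j).nonunits := by
      rw [← hM j ⟨s, hs⟩, ← hij, hM i]; exact hsu
    rw [ValuationSubring.mem_nonunits_iff_or, not_or, not_not] at hsj
    have : x = s⁻¹ * (s * x) := by rw [inv_mul_cancel_left₀ hsj.1]
    rw [this]
    exact mul_mem hsj.2 (hB j ⟨_, hsx⟩)
  have hcop : Pairwise (Function.onFun IsCoprime M) := by
    intro i j hij
    have := hmax i
    have := hmax j
    refine Ideal.isCoprime_of_isMaximal ?_
    intro h
    exact hdist i j hij (le_antisymm (hle i j h) (hle j i h.symm))
  have hsurj : ∀ i, ∃ b : B, IsLocalRing.residue (W i) (f i b) = a i := by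
    intro i
    obtain ⟨⟨x, hx⟩, hxa⟩ := IsLocalRing.residue_surjective (a i)
    obtain ⟨s, hs, hsx, hsu⟩ := aux_frac v (W i) x hx
    have hsM : (⟨s, hs⟩ : B) ∉ M i := by rw [hM]; exact hsu
    obtain ⟨t, ht⟩ := (hmax i).exists_inv hsM
    obtain ⟨m, hm, htm⟩ := ht
    refine ⟨⟨s * x, hsx⟩ * t, ?_⟩
    have h1 : IsLocalRing.residue (W i) (f i (t * ⟨s, hs⟩)) = 1 := by
      have hm0 : IsLocalRing.residue (W i) (f i m) = 0 :=
        (IsLocalRing.residue_eq_zero_iff _).mpr hm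
      have := congrArg (fun z => IsLocalRing.residue (W i) (f i z)) htm
      simpa only [map_add, map_one, hm0, add_zero] using this
    have h2 : f i (⟨s * x, hsx⟩ * t) = f i (t * ⟨s, hs⟩) * ⟨x, hx⟩ := by
      apply Subtype.ext
      change s * x * (t : L) = (t : L) * s * x
      ring
    rw [h2, map_mul, h1, one_mul, hxa]
  choose b hb using hsurj
  obtain ⟨r, hr⟩ := Ideal.exists_forall_sub_mem_ideal hcop b
  refine ⟨r, r.2, fun i => ⟨hB i r, ?_⟩⟩
  rw [← hb i]
  change IsLocalRing.residue (W i) (f i r) = _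
  rw [← sub_eq_zero, ← map_sub, ← map_sub]
  exact (IsLocalRing.residue_eq_zero_iff _).mpr (hr i)
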